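/- Let 1 < q < ∞ and suppose α/n > β/m and (α+ρβ)/(n+ρm) = 1 − 1/q. Then there exists a constant C, depending only on n, m, α, β, ρ, q (and not on L or a), such that ∑_{k≥1} ∬_{Q_{k0}} |I a(x,y)|^q dx dy ≤ C for every L ∈ ℤ and every measurable a supported in ½Q with |a| ≤ 2^{(n+m)(1−L)} pointwise and ∬ a(x,y) dx dy = 0. -/

import Mathlib

open MeasureTheory

/-- The flag kernel `Ω(x,y) = |x|^(α-n) (|x|^ρ + |y|)^(β-m)` on `ℝ^n × ℝ^m`. -/
noncomputable def flagKernel (n m : ℕ) (α β ρ : ℝ)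
    (x : EuclideanSpace ℝ (Fin n)) (y : EuclideanSpace ℝ (Fin m)) : ℝ :=
  ‖x‖ ^ (α - (n : ℝ)) * (‖x‖ ^ ρ + ‖y‖) ^ (β - (m : ℝ))

/-- The fractional integral operator `I f(x,y) = ∬ f(u,v) Ω(x-u, y-v) du dv`. -/
noncomputable def flagOp (n m : ℕ) (α β ρ : ℝ)
    (f : EuclideanSpace ℝ (Fin n) × EuclideanSpace ℝ (Fin m) → ℝ)
    (z : EuclideanSpace ℝ (Fin n) × EuclideanSpace ℝ (Fin m)) : ℝ :=
  ∫ w : EuclideanSpace ℝ (Fin n) × EuclideanSpace ℝ (Fin m),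
    f w * flagKernel n m α β ρ (z.1 - w.1) (z.2 - w.2)

/-- The `ℓ^∞` (sup) norm `‖x‖_∞` of a point of Euclidean space. -/
noncomputable def supAbs {n : ℕ} (x : EuclideanSpace ℝ (Fin n)) : ℝ :=
  ‖(WithLp.equiv 2 (Fin n → ℝ)) x‖

open Set Metric in
theorem integrableOn_and_setIntegral_norm_rpow_closedBall {m : ℕ} (hm : 0 < m) {β T : ℝ}
    (hβ : 0 < β) (hT : 0 ≤ T) :
    IntegrableOn (fun v : EuclideanSpace ℝ (Fin m) => ‖v‖ ^ (β - (m : ℝ))) (closedBall 0 T) ∧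
      ∫ v in closedBall (0 : EuclideanSpace ℝ (Fin m)) T, ‖v‖ ^ (β - (m : ℝ)) =
        m * volume.real (ball (0 : EuclideanSpace ℝ (Fin m)) 1) * (T ^ β / β) := by
  have : Nonempty (Fin m) := ⟨⟨0, hm⟩⟩
  have hind : (closedBall (0 : EuclideanSpace ℝ (Fin m)) T).indicator
      (fun v => ‖v‖ ^ (β - (m : ℝ))) =
      fun v => (Iic T).indicator (fun t : ℝ => t ^ (β - (m : ℝ))) ‖v‖ := by
    ext v
    simp [indicator]
  have hrad : EqOn (fun t : ℝ => t ^ (m - 1) • (Iic T).indicator (fun t : ℝ => t ^ (β - (m : ℝ))) t)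
      ((Iic T).indicator fun t : ℝ => t ^ (β - 1)) (Ioi 0) := by
    intro t (ht : 0 < t)
    by_cases h : t ≤ T
    · simp only [indicator, mem_Iic, h, if_true, smul_eq_mul]
      rw [← Real.rpow_natCast, ← Real.rpow_add ht, Nat.cast_sub hm]
      congr 1
      push_cast
      ring
    · simp [indicator, h]
  have hdom : Ioi (0 : ℝ) ∩ Iic T = Ioc 0 T := rfl
  constructor
  · rw [← integrable_indicator_iff measurableSet_closedBall, hind,
      integrable_fun_norm_addHaar volume, finrank_euclideanSpace_fin,
      integrableOn_congr_fun hrad measurableSet_Ioi, IntegrableOn,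
      integrable_indicator_iff measurableSet_Iic, IntegrableOn,
      Measure.restrict_restrict measurableSet_Iic, inter_comm, hdom]
    exact (intervalIntegrable_iff_integrableOn_Ioc_of_le hT).1
      (intervalIntegral.intervalIntegrable_rpow' (by linarith))
  · rw [← integral_indicator measurableSet_closedBall, hind,
      integral_fun_norm_addHaar volume, finrank_euclideanSpace_fin,
      setIntegral_congr_fun measurableSet_Ioi hrad, setIntegral_indicator measurableSet_Iic, hdom,
      ← intervalIntegral.integral_of_le hT, integral_rpow (Or.inl (by linarith))]
    simp [Real.zero_rpow hβ.ne', mul_assoc]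

open Set Metric in
theorem abs_flagOp_le {n m : ℕ} (hm : 0 < m) {α β ρ A D s T : ℝ} (hαn : α < n)
    (hβm : β < m) (hρ : 0 ≤ ρ) (hA : 0 ≤ A) (hD : 0 < D)
    {a : EuclideanSpace ℝ (Fin n) × EuclideanSpace ℝ (Fin m) → ℝ} (haA : ∀ w, |a w| ≤ A)
    {z : EuclideanSpace ℝ (Fin n) × EuclideanSpace ℝ (Fin m)}
    (hz : ∀ w, a w ≠ 0 → ‖w.1‖ ≤ s ∧ D ≤ ‖z.1 - w.1‖ ∧ ‖z.2 - w.2‖ ≤ T)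
    {g : ℝ → ℝ} (hg : ∀ t, 0 < t → (D ^ ρ + t) ^ (β - (m : ℝ)) ≤ g t)
    (hgint : IntegrableOn (fun v : EuclideanSpace ℝ (Fin m) => g ‖v‖) (closedBall 0 T)) :
    |flagOp n m α β ρ a z| ≤ A * D ^ (α - (n : ℝ)) *
      (volume.real (closedBall (0 : EuclideanSpace ℝ (Fin n)) s) *
        ∫ v in closedBall (0 : EuclideanSpace ℝ (Fin m)) T, g ‖v‖) := by
  have : Nonempty (Fin m) := ⟨⟨0, hm⟩⟩
  set G : EuclideanSpace ℝ (Fin m) → ℝ := (closedBall 0 T).indicator fun v => g ‖v‖ with hGdef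
  set X : EuclideanSpace ℝ (Fin n) → ℝ := (closedBall 0 s).indicator fun _ => (1 : ℝ) with hXdef
  have hG : Integrable G := (integrable_indicator_iff measurableSet_closedBall).2 hgint
  have hX : Integrable X := (integrable_indicator_iff measurableSet_closedBall).2
    (integrableOn_const measure_closedBall_lt_top.ne)
  have hF : Integrable (fun w : EuclideanSpace ℝ (Fin n) × EuclideanSpace ℝ (Fin m) =>
      A * D ^ (α - (n : ℝ)) * (X w.1 * G (z.2 - w.2))) :=
    (hX.mul_prod (hG.comp_sub_left z.2)).const_mul _
  have hne : ∀ᵐ w : EuclideanSpace ℝ (Fin n) × EuclideanSpace ℝ (Fin m), w.2 ≠ z.2 :=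
    Measure.quasiMeasurePreserving_snd.ae (Measure.ae_ne volume z.2)
  calc |flagOp n m α β ρ a z|
      ≤ ∫ w : EuclideanSpace ℝ (Fin n) × EuclideanSpace ℝ (Fin m),
          A * D ^ (α - (n : ℝ)) * (X w.1 * G (z.2 - w.2)) := by
        rw [← Real.norm_eq_abs, flagOp]
        refine norm_integral_le_of_norm_le hF ?_
        filter_upwards [hne] with w hw
        have hpos : 0 < ‖z.2 - w.2‖ := norm_pos_iff.2 (sub_ne_zero.2 hw.symm)
        by_cases haw : a w = 0
        · rw [haw, zero_mul, norm_zero]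
          have : 0 ≤ G (z.2 - w.2) := by
            simp only [hGdef, indicator]
            split_ifs
            · exact le_trans (by positivity) (hg _ hpos)
            · exact le_rfl
          have : 0 ≤ X w.1 := indicator_nonneg (fun _ _ => zero_le_one) _
          positivity
        · obtain ⟨h1, h2, h3⟩ := hz w haw
          have hXw : X w.1 = 1 := by simp [hXdef, h1]
          have hGw : G (z.2 - w.2) = g ‖z.2 - w.2‖ := by simp [hGdef, h3]
          have hfac : ‖z.1 - w.1‖ ^ (α - (n : ℝ)) ≤ D ^ (α - (n : ℝ)) :=
            Real.rpow_le_rpow_of_nonpos hD h2 (by linarith)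
          have hfac2 : (‖z.1 - w.1‖ ^ ρ + ‖z.2 - w.2‖) ^ (β - (m : ℝ)) ≤ g ‖z.2 - w.2‖ := by
            refine le_trans (Real.rpow_le_rpow_of_nonpos (by positivity) ?_ (by linarith))
              (hg _ hpos)
            gcongr
          rw [hXw, hGw, one_mul, flagKernel, Real.norm_eq_abs, abs_mul, abs_of_nonneg
            (a := _ * _) (by positivity), mul_assoc]
          gcongr
          exact haA w
    _ = _ := by
        rw [integral_const_mul, Measure.volume_eq_prod,
          integral_prod_mul X (fun v => G (z.2 - v)), integral_sub_left_eq_self G volume z.2,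
          integral_indicator measurableSet_closedBall, integral_indicator measurableSet_closedBall]
        simp

theorem supAbs_le_norm {n : ℕ} (x : EuclideanSpace ℝ (Fin n)) : supAbs x ≤ ‖x‖ := by
  simpa [supAbs] using (PiLp.lipschitzWith_ofLp 2 (fun _ : Fin n => ℝ)).norm_le_mul rfl x

theorem norm_le_sqrt_mul_supAbs {n : ℕ} (x : EuclideanSpace ℝ (Fin n)) :
    ‖x‖ ≤ √n * supAbs x := by
  have h := (PiLp.antilipschitzWith_ofLp 2 (fun _ : Fin n => ℝ)).le_mul_norm rfl x
  simpa [supAbs, Real.sqrt_eq_rpow] using h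

theorem supAbs_le_add_supAbs_sub {n : ℕ} (x y : EuclideanSpace ℝ (Fin n)) :
    supAbs x ≤ supAbs y + supAbs (x - y) := by
  simpa [supAbs, add_comm] using norm_le_norm_add_norm_sub' (WithLp.ofLp x) (WithLp.ofLp y)

theorem supAbs_sub_le {n : ℕ} (x y : EuclideanSpace ℝ (Fin n)) :
    supAbs (x - y) ≤ supAbs x + supAbs y := by
  simpa [supAbs] using norm_sub_le (WithLp.ofLp x) (WithLp.ofLp y)

theorem exists_tsum_two_rpow_neg_abs_le {c : ℝ} (hc : 0 < c) :
    ∃ S : ℝ, 0 ≤ S ∧ ∀ x : ℝ,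
      ∑' k : ℕ, ENNReal.ofReal ((2 : ℝ) ^ (-(c * |(k : ℝ) + x|))) ≤ ENNReal.ofReal S := by
  have hgeo : Summable fun k : ℕ => (2 : ℝ) ^ (-(c * (k : ℝ))) := by
    have h := summable_geometric_of_lt_one (r := (2 : ℝ) ^ (-c)) (by positivity)
      (Real.rpow_lt_one_of_one_lt_of_neg one_lt_two (by linarith))
    refine h.congr fun k => ?_
    rw [← Real.rpow_natCast, ← Real.rpow_mul (by norm_num), neg_mul]
  have hsum : Summable fun k : ℤ => (2 : ℝ) ^ (c - c * |(k : ℝ)|) := by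
    have : Summable fun k : ℤ => (2 : ℝ) ^ (-(c * |(k : ℝ)|)) := by
      rw [summable_int_iff_summable_nat_and_neg]
      exact ⟨by simpa using hgeo, by simpa using hgeo⟩
    refine (this.mul_left ((2 : ℝ) ^ c)).congr fun k => ?_
    rw [← Real.rpow_add (by norm_num), sub_eq_add_neg]
  refine ⟨∑' k : ℤ, (2 : ℝ) ^ (c - c * |(k : ℝ)|), tsum_nonneg fun k => by positivity,
    fun x => ?_⟩
  rw [ENNReal.ofReal_tsum_of_nonneg (fun k => by positivity) hsum]
  calc ∑' k : ℕ, ENNReal.ofReal ((2 : ℝ) ^ (-(c * |(k : ℝ) + x|)))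
      ≤ ∑' k : ℕ, ENNReal.ofReal ((2 : ℝ) ^ (c - c * |(((k : ℤ) + ⌊x⌋ : ℤ) : ℝ)|)) := by
        refine ENNReal.tsum_le_tsum fun k => ENNReal.ofReal_le_ofReal ?_
        refine Real.rpow_le_rpow_of_exponent_le one_le_two ?_
        have h : |(((k : ℤ) + ⌊x⌋ : ℤ) : ℝ)| ≤ |(k : ℝ) + x| + 1 := by
          push_cast
          have h1 := Int.floor_le x
          have h2 := Int.lt_floor_add_one x
          rw [abs_le]
          constructor <;> linarith [neg_abs_le ((k : ℝ) + x), le_abs_self ((k : ℝ) + x)]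
        nlinarith
    _ ≤ ∑' k : ℤ, ENNReal.ofReal ((2 : ℝ) ^ (c - c * |(k : ℝ)|)) :=
        ENNReal.tsum_comp_le_tsum_of_injective
          (f := fun k : ℕ => (k : ℤ) + ⌊x⌋) (fun i j h => by simpa using h)
          (fun k : ℤ => ENNReal.ofReal ((2 : ℝ) ^ (c - c * |(k : ℝ)|)))

open Metric in
theorem exists_abs_flagOp_le {n m : ℕ} (hm : 0 < m) {α β ρ : ℝ} (hαn : α < n) (hβ : 0 < β)
    (hβm : β < m) (hρ : 0 ≤ ρ) :
    ∃ C : ℝ, 0 ≤ C ∧ ∀ (r R : ℝ), 0 < r → r ≤ R →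
      ∀ a : EuclideanSpace ℝ (Fin n) × EuclideanSpace ℝ (Fin m) → ℝ,
        (∀ w, a w ≠ 0 → max (supAbs w.1) (supAbs w.2) ≤ r / 4) →
        (∀ w, |a w| ≤ (2 / r) ^ (n + m)) →
        ∀ z : EuclideanSpace ℝ (Fin n) × EuclideanSpace ℝ (Fin m),
          R ≤ supAbs z.1 → supAbs z.2 ≤ r →
          |flagOp n m α β ρ a z| ≤ C * (R ^ (α - (n : ℝ)) * R ^ (ρ * (β - (m : ℝ)))) ∧
          |flagOp n m α β ρ a z| ≤ C * (R ^ (α - (n : ℝ)) * r ^ (β - (m : ℝ))) := by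
  set Vn := volume.real (ball (0 : EuclideanSpace ℝ (Fin n)) 1) with hVn
  set Vm := volume.real (ball (0 : EuclideanSpace ℝ (Fin m)) 1) with hVm
  set K : ℝ := 2 ^ (n + m) * (1 / 2) ^ (α - (n : ℝ)) * (√n ^ n * Vn) with hK
  set C₁ : ℝ := K * ((1 / 2) ^ (ρ * (β - (m : ℝ))) * ((2 * √m) ^ m * Vm)) with hC₁
  set C₂ : ℝ := K * (m * Vm * ((2 * √m) ^ β / β)) with hC₂
  have hVn0 : 0 ≤ Vn := measureReal_nonneg
  have hVm0 : 0 ≤ Vm := measureReal_nonneg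
  have hC₁0 : 0 ≤ C₁ := by positivity
  have hC₂0 : 0 ≤ C₂ := by positivity
  refine ⟨max C₁ C₂, le_max_of_le_left hC₁0, fun r R hr hrR a hsupp hbd z hz1 hz2 => ?_⟩
  have hR : 0 < R := hr.trans_le hrR
  have hz : ∀ w, a w ≠ 0 →
      ‖w.1‖ ≤ √n * r ∧ R / 2 ≤ ‖z.1 - w.1‖ ∧ ‖z.2 - w.2‖ ≤ 2 * √m * r := by
    intro w hw
    obtain ⟨h1, h2⟩ := max_le_iff.1 (hsupp w hw)
    refine ⟨(norm_le_sqrt_mul_supAbs _).trans ?_, ?_, (norm_le_sqrt_mul_supAbs _).trans ?_⟩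
    · gcongr
      linarith
    · linarith [supAbs_le_norm (z.1 - w.1), supAbs_le_add_supAbs_sub z.1 w.1]
    · rw [mul_comm (2 : ℝ), mul_assoc]
      gcongr
      linarith [supAbs_sub_le z.2 w.2]
  have hballn : volume.real (closedBall (0 : EuclideanSpace ℝ (Fin n)) (√n * r)) =
      (√n * r) ^ n * Vn := by
    rw [Measure.addHaar_real_closedBall _ _ (by positivity), finrank_euclideanSpace_fin]
  have hballm : volume.real (closedBall (0 : EuclideanSpace ℝ (Fin m)) (2 * √m * r)) =
      (2 * √m * r) ^ m * Vm := by
    rw [Measure.addHaar_real_closedBall _ _ (by positivity), finrank_euclideanSpace_fin]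
  have hhalf : ∀ e : ℝ, (R / 2) ^ e = (1 / 2) ^ e * R ^ e := fun e => by
    rw [← Real.mul_rpow (by norm_num) hR.le]
    congr 1
    ring
  constructor
  · have h := abs_flagOp_le hm hαn hβm hρ (by positivity) (half_pos hR) hbd hz
      (g := fun _ => (R / 2) ^ (ρ * (β - (m : ℝ))))
      (fun t ht => by
        rw [Real.rpow_mul (by positivity)]
        exact Real.rpow_le_rpow_of_nonpos (by positivity) (by linarith) (by linarith))
      (integrableOn_const measure_closedBall_lt_top.ne)
    rw [setIntegral_const, hballn, hballm, hhalf, hhalf, smul_eq_mul] at h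
    have heq : (2 / r) ^ (n + m) * ((1 / 2) ^ (α - (n : ℝ)) * R ^ (α - (n : ℝ))) *
        ((√n * r) ^ n * Vn * ((2 * √m * r) ^ m * Vm *
          ((1 / 2) ^ (ρ * (β - (m : ℝ))) * R ^ (ρ * (β - (m : ℝ)))))) =
        C₁ * (R ^ (α - (n : ℝ)) * R ^ (ρ * (β - (m : ℝ)))) := by
      rw [hC₁, hK, div_pow, mul_pow (√n), mul_pow (2 * √m), pow_add r]
      field_simp
    exact (h.trans_eq heq).trans (by gcongr; exact le_max_left _ _)
  · obtain ⟨hint, hval⟩ := integrableOn_and_setIntegral_norm_rpow_closedBall hm hβ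
      (T := 2 * √m * r) (by positivity)
    have h := abs_flagOp_le hm hαn hβm hρ (by positivity) (half_pos hR) hbd hz
      (g := fun t => t ^ (β - (m : ℝ)))
      (fun t ht => Real.rpow_le_rpow_of_nonpos ht (le_add_of_nonneg_left (by positivity))
        (by linarith)) hint
    rw [hval, hballn, hhalf] at h
    have heq : (2 / r) ^ (n + m) * ((1 / 2) ^ (α - (n : ℝ)) * R ^ (α - (n : ℝ))) *
        ((√n * r) ^ n * Vn * (m * Vm * ((2 * √m * r) ^ β / β))) =
        C₂ * (R ^ (α - (n : ℝ)) * r ^ (β - (m : ℝ))) := by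
      rw [hC₂, hK, div_pow, mul_pow (√n), Real.mul_rpow (z := β) (by positivity) hr.le,
        pow_add r, Real.rpow_sub hr, Real.rpow_natCast]
      field_simp
    exact (h.trans_eq heq).trans (by gcongr; exact le_max_right _ _)

open Set Metric in
theorem exists_volume_supAbs_lt_le (n m : ℕ) :
    ∃ V : ℝ, 0 ≤ V ∧ ∀ s t : ℝ, 0 ≤ s → 0 ≤ t →
      volume {w : EuclideanSpace ℝ (Fin n) × EuclideanSpace ℝ (Fin m) |
        supAbs w.1 < s ∧ supAbs w.2 < t} ≤ ENNReal.ofReal (V * (s ^ n * t ^ m)) := by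
  refine ⟨√n ^ n * volume.real (ball (0 : EuclideanSpace ℝ (Fin n)) 1) *
    (√m ^ m * volume.real (ball (0 : EuclideanSpace ℝ (Fin m)) 1)), by positivity,
    fun s t hs ht => ?_⟩
  have hsub : {w : EuclideanSpace ℝ (Fin n) × EuclideanSpace ℝ (Fin m) |
      supAbs w.1 < s ∧ supAbs w.2 < t} ⊆
      closedBall 0 (√n * s) ×ˢ closedBall 0 (√m * t) := by
    rintro w ⟨h1, h2⟩
    simp only [mem_prod, mem_closedBall, dist_zero_right]
    exact ⟨(norm_le_sqrt_mul_supAbs _).trans (by gcongr),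
      (norm_le_sqrt_mul_supAbs _).trans (by gcongr)⟩
  refine (measure_mono hsub).trans_eq ?_
  rw [Measure.volume_eq_prod, Measure.prod_prod, ← ofReal_measureReal measure_closedBall_lt_top.ne,
    ← ofReal_measureReal measure_closedBall_lt_top.ne, ← ENNReal.ofReal_mul measureReal_nonneg,
    Measure.addHaar_real_closedBall _ _ (by positivity),
    Measure.addHaar_real_closedBall _ _ (by positivity), finrank_euclideanSpace_fin,
    finrank_euclideanSpace_fin]
  congr 1
  ring

theorem exists_min_two_rpow_le_of_homogeneity {n m : ℕ} (hn : 0 < n) (hm : 0 < m) {α β ρ q : ℝ}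
    (hρ : 1 ≤ ρ) (hq : 1 < q) (hmain : β / m < α / n)
    (hhom : (α + ρ * β) / (n + ρ * m) = 1 - 1 / q) :
    ∃ c : ℝ, 0 < c ∧ ∀ X l : ℝ,
      min (((α - n) * X + ρ * (β - m) * X) * q + (n * X + m * l))
        (((α - n) * X + (β - m) * l) * q + (n * X + m * l)) ≤ -(c * |X - l / ρ|) := by
  have hn' : (0 : ℝ) < n := by exact_mod_cast hn
  have hm' : (0 : ℝ) < m := by exact_mod_cast hm
  have hρ0 : 0 < ρ := by linarith
  have hq0 : 0 < q := by linarith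
  have hscale : q * (α + ρ * β) = (q - 1) * (n + ρ * m) := by
    rw [div_eq_iff (by positivity)] at hhom
    rw [hhom]
    field_simp
  have hA : 0 < q * (α - n) + n := by
    rw [div_lt_div_iff₀ hm' hn'] at hmain
    have h : 0 < (q * (α - n) + n) * (n + ρ * m) := by
      have : (q * (α - n) + n) * (n + ρ * m) = q * ρ * (α * m - β * n) := by
        linear_combination (n : ℝ) * hscale
      rw [this]
      have := sub_pos.2 hmain
      positivity
    exact pos_of_mul_pos_left h (by positivity)
  refine ⟨min (ρ * m) (q * (α - n) + n), lt_min (by positivity) hA, fun X l => ?_⟩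
  set c := min (ρ * (m : ℝ)) (q * (α - n) + n) with hc
  have h1 : ((α - n) * X + ρ * (β - m) * X) * q + (n * X + m * l) = -(ρ * m * (X - l / ρ)) := by
    field_simp
    linear_combination X * hscale
  have h2 : ((α - n) * X + (β - m) * l) * q + (n * X + m * l) =
      (q * (α - n) + n) * (X - l / ρ) := by
    field_simp
    linear_combination l * hscale
  rw [h1, h2]
  rcases le_total 0 (X - l / ρ) with h | h
  · rw [abs_of_nonneg h]
    refine (min_le_left _ _).trans (neg_le_neg ?_)
    gcongr
    exact min_le_left _ _
  · rw [abs_of_nonpos h, mul_neg, neg_neg]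
    exact (min_le_right _ _).trans (mul_le_mul_of_nonpos_right (min_le_right _ _) h)

/-- Case 3 (`k > 0, ℓ = 0`): the sum over `k ≥ 1` of the integrals of `|I a|^q`
over the shells `Q_{k0}` is uniformly bounded for functions `a` supported in `½Q`
with `|a| ≤ 2^{(n+m)(1-L)}` and vanishing integral. -/
theorem flagOp_atom_case3 (n m : ℕ) (hn : 0 < n) (hm : 0 < m) (α β ρ q : ℝ)
    (hα : 0 < α) (hαn : α < n) (hβ : 0 < β) (hβm : β < m) (hρ : 1 ≤ ρ)
    (hq : 1 < q)
    (hmain : β / m < α / n)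
    (hhom : (α + ρ * β) / (n + ρ * m) = 1 - 1 / q) :
    ∃ C : ℝ, 0 < C ∧
      ∀ (L : ℤ) (a : EuclideanSpace ℝ (Fin n) × EuclideanSpace ℝ (Fin m) → ℝ),
        Measurable a →
        (∀ w, a w ≠ 0 → max (supAbs w.1) (supAbs w.2) ≤ (2 : ℝ) ^ (L - 2)) →
        (∀ w, |a w| ≤ (2 : ℝ) ^ (((n : ℤ) + m) * (1 - L))) →
        (∫ w : EuclideanSpace ℝ (Fin n) × EuclideanSpace ℝ (Fin m), a w) = 0 →
        ∑' (k : ℕ),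
          ∫⁻ w in {w : EuclideanSpace ℝ (Fin n) × EuclideanSpace ℝ (Fin m) |
              ((2 : ℝ) ^ (L + ((k : ℤ) + 1) - 1) ≤ supAbs w.1 ∧
                supAbs w.1 < (2 : ℝ) ^ (L + ((k : ℤ) + 1))) ∧
              supAbs w.2 < (2 : ℝ) ^ L},
            ENNReal.ofReal (|flagOp n m α β ρ a w| ^ q) ≤ ENNReal.ofReal C := by
  have hρ0 : 0 ≤ ρ := by linarith
  have hq0 : 0 ≤ q := by linarith
  obtain ⟨C, hC, hbound⟩ := exists_abs_flagOp_le hm hαn hβ hβm hρ0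
  obtain ⟨V, hV, hvol⟩ := exists_volume_supAbs_lt_le n m
  obtain ⟨c, hc, hmin⟩ := exists_min_two_rpow_le_of_homogeneity hn hm hρ hq hmain hhom
  obtain ⟨S, hS, hsum⟩ := exists_tsum_two_rpow_neg_abs_le hc
  set M : ℝ := C ^ q * (V * 2 ^ n) with hM
  refine ⟨M * S + 1, by positivity, fun L a _ hsupp hbd _ => ?_⟩
  have hterm : ∀ k : ℕ,
      ∫⁻ w in {w : EuclideanSpace ℝ (Fin n) × EuclideanSpace ℝ (Fin m) |
          ((2 : ℝ) ^ (L + ((k : ℤ) + 1) - 1) ≤ supAbs w.1 ∧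
            supAbs w.1 < (2 : ℝ) ^ (L + ((k : ℤ) + 1))) ∧
          supAbs w.2 < (2 : ℝ) ^ L},
        ENNReal.ofReal (|flagOp n m α β ρ a w| ^ q) ≤
      ENNReal.ofReal M * ENNReal.ofReal ((2 : ℝ) ^ (-(c * |(k : ℝ) + (L - L / ρ)|))) := by
    intro k
    set r : ℝ := (2 : ℝ) ^ (L : ℝ) with hr
    set R : ℝ := (2 : ℝ) ^ ((L : ℝ) + k) with hR
    have hr0 : 0 < r := by positivity
    have hR0 : 0 < R := by positivity
    have hrR : r ≤ R := Real.rpow_le_rpow_of_exponent_le one_le_two (by simp)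
    have hrL : (2 : ℝ) ^ L = r := (Real.rpow_intCast 2 L).symm
    have hRL : (2 : ℝ) ^ (L + ((k : ℤ) + 1) - 1) = R := by
      rw [hR, ← Real.rpow_intCast]
      push_cast
      ring_nf
    have hRL' : (2 : ℝ) ^ (L + ((k : ℤ) + 1)) = 2 * R := by
      rw [← hRL, ← zpow_one_add₀ two_ne_zero]
      ring_nf
    rw [hRL, hRL', hrL]
    have hsupp' : ∀ w, a w ≠ 0 → max (supAbs w.1) (supAbs w.2) ≤ r / 4 := fun w hw =>
      (hsupp w hw).trans_eq (by rw [zpow_sub₀ two_ne_zero, hrL]; norm_num)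
    have hbd' : ∀ w, |a w| ≤ (2 / r) ^ (n + m) := fun w =>
      (hbd w).trans_eq (by
        rw [mul_comm, zpow_mul, zpow_sub₀ two_ne_zero, hrL, zpow_one]
        exact_mod_cast zpow_natCast (2 / r) (n + m))
    have hpow : ∀ e : ℝ, R ^ e = 2 ^ (((L : ℝ) + k) * e) ∧ r ^ e = 2 ^ ((L : ℝ) * e) := fun e =>
      ⟨(Real.rpow_mul zero_le_two _ _).symm, (Real.rpow_mul zero_le_two _ _).symm⟩
    set X : ℝ := (L : ℝ) + k with hX
    set E : ℝ := min ((α - n) * X + ρ * (β - m) * X) ((α - n) * X + (β - m) * L) with hE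
    have hpt : ∀ z : EuclideanSpace ℝ (Fin n) × EuclideanSpace ℝ (Fin m),
        R ≤ supAbs z.1 → supAbs z.2 ≤ r → |flagOp n m α β ρ a z| ≤ C * 2 ^ E := by
      intro z h1 h2
      obtain ⟨hb1, hb2⟩ := hbound r R hr0 hrR a hsupp' hbd' z h1 h2
      rw [(hpow _).1, (hpow _).1, ← Real.rpow_add two_pos] at hb1
      rw [(hpow _).1, (hpow _).2, ← Real.rpow_add two_pos] at hb2
      rcases min_choice ((α - n) * X + ρ * (β - m) * X) ((α - n) * X + (β - m) * L) with h | h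
      · rw [hE, h]
        convert hb1 using 3
        ring
      · rw [hE, h]
        convert hb2 using 3
        ring
    have hexp : E * q + (n * X + m * L) ≤ -(c * |(k : ℝ) + (L - L / ρ)|) := by
      have h := hmin X L
      rw [min_add_add_right, ← min_mul_of_nonneg _ _ hq0] at h
      convert h using 4
      rw [hX]
      ring
    calc ∫⁻ w in {w : EuclideanSpace ℝ (Fin n) × EuclideanSpace ℝ (Fin m) |
            (R ≤ supAbs w.1 ∧ supAbs w.1 < 2 * R) ∧ supAbs w.2 < r},
          ENNReal.ofReal (|flagOp n m α β ρ a w| ^ q)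
        ≤ ∫⁻ _ in {w : EuclideanSpace ℝ (Fin n) × EuclideanSpace ℝ (Fin m) |
            (R ≤ supAbs w.1 ∧ supAbs w.1 < 2 * R) ∧ supAbs w.2 < r},
          ENNReal.ofReal ((C * 2 ^ E) ^ q) := by
          refine setLIntegral_mono measurable_const fun w hw => ENNReal.ofReal_le_ofReal ?_
          exact Real.rpow_le_rpow (abs_nonneg _) (hpt w hw.1.1 hw.2.le) hq0
      _ ≤ ENNReal.ofReal ((C * 2 ^ E) ^ q) * ENNReal.ofReal (V * ((2 * R) ^ n * r ^ m)) := by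
          rw [setLIntegral_const]
          gcongr
          refine (measure_mono fun w hw => ?_).trans (hvol (2 * R) r (by positivity) hr0.le)
          exact ⟨hw.1.2, hw.2⟩
      _ = ENNReal.ofReal (M * 2 ^ (E * q + (n * X + m * L))) := by
          rw [← ENNReal.ofReal_mul (by positivity), hM, Real.mul_rpow hC (by positivity),
            Real.rpow_add two_pos, Real.rpow_add two_pos, ← Real.rpow_mul zero_le_two, mul_pow,
            ← Real.rpow_natCast R, ← Real.rpow_natCast r, (hpow _).1, (hpow _).2, mul_comm X,
            mul_comm (L : ℝ)]
          congr 1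
          ring
      _ ≤ ENNReal.ofReal (M * (2 : ℝ) ^ (-(c * |(k : ℝ) + (L - L / ρ)|))) := by
          refine ENNReal.ofReal_le_ofReal (mul_le_mul_of_nonneg_left ?_ (by positivity))
          exact Real.rpow_le_rpow_of_exponent_le one_le_two hexp
      _ = _ := ENNReal.ofReal_mul (by positivity)
  calc _ ≤ ∑' k : ℕ, ENNReal.ofReal M *
          ENNReal.ofReal ((2 : ℝ) ^ (-(c * |(k : ℝ) + (L - L / ρ)|))) :=
        ENNReal.tsum_le_tsum hterm
    _ ≤ ENNReal.ofReal M * ENNReal.ofReal S := by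
        rw [ENNReal.tsum_mul_left]
        gcongr
        exact hsum _
    _ = ENNReal.ofReal (M * S) := (ENNReal.ofReal_mul (by positivity)).symm
    _ ≤ ENNReal.ofReal (M * S + 1) := ENNReal.ofReal_le_ofReal (by linarith)
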